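/- Let F be a field containing ℂ as a subfield and let s : F → F be a field automorphism with s∘s = id whose restriction to ℂ is complex conjugation. Let K be the fixed field of s. Then [F : K] = 2, K ∩ ℂ = ℝ, and the natural multiplication map K ⊗_ℝ ℂ → F is an isomorphism of ℂ-algebras (i.e., F = K ⊗_ℝ ℂ). -/

import Mathlib

/-!
STATEMENT 3: Let `F` be a field containing `ℂ` as a subfield and `s : F → F` a field
automorphism with `s ∘ s = id` whose restriction to `ℂ` is complex conjugation.  Let
`K` be the fixed field of `s`.  Then `[F : K] = 2`, `K ∩ ℂ = ℝ`, and the natural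
multiplication map `K ⊗[ℝ] ℂ → F` is an isomorphism (of `ℂ`-algebras, and in
particular of `ℝ`-algebras).
-/

open scoped TensorProduct

/-- The fixed field `K = {x : F | s x = x}` of a field automorphism `s` of `F`
restricting to complex conjugation on `ℂ`, as an intermediate field of `ℝ ⊆ F`. -/
def fixedField (F : Type) [Field F] [Algebra ℝ F] [Algebra ℂ F] [IsScalarTower ℝ ℂ F]
    (s : F ≃+* F)
    (hconj : ∀ z : ℂ, s (algebraMap ℂ F z) = algebraMap ℂ F (starRingEnd ℂ z)) :
    IntermediateField ℝ F where
  carrier := {x : F | s x = x}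
  mul_mem' := fun {a b} ha hb => by
    simp only [Set.mem_setOf_eq] at *
    rw [map_mul, ha, hb]
  one_mem' := map_one s
  add_mem' := fun {a b} ha hb => by
    simp only [Set.mem_setOf_eq] at *
    rw [map_add, ha, hb]
  zero_mem' := map_zero s
  algebraMap_mem' := fun r => by
    show s (algebraMap ℝ F r) = algebraMap ℝ F r
    rw [IsScalarTower.algebraMap_apply ℝ ℂ F, hconj]
    congr 1
    simp [Complex.conj_ofReal]
  inv_mem' := fun x hx => by
    show s x⁻¹ = x⁻¹
    rw [map_inv₀]
    exact congrArg Inv.inv hx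

theorem mem_fixedField_iff {F : Type} [Field F] [Algebra ℝ F] [Algebra ℂ F] [IsScalarTower ℝ ℂ F]
    (s : F ≃+* F)
    (hconj : ∀ z : ℂ, s (algebraMap ℂ F z) = algebraMap ℂ F (starRingEnd ℂ z))
    {x : F} : x ∈ fixedField F s hconj ↔ s x = x :=
  Iff.rfl

theorem algebraMap_I_mul_self (F : Type) [Field F] [Algebra ℂ F] :
    algebraMap ℂ F Complex.I * algebraMap ℂ F Complex.I = -1 := by
  rw [← map_mul, Complex.I_mul_I, map_neg, map_one]

theorem map_algebraMap_I {F : Type} [Field F] [Algebra ℝ F] [Algebra ℂ F] [IsScalarTower ℝ ℂ F]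
    (s : F ≃+* F)
    (hconj : ∀ z : ℂ, s (algebraMap ℂ F z) = algebraMap ℂ F (starRingEnd ℂ z)) :
    s (algebraMap ℂ F Complex.I) = -algebraMap ℂ F Complex.I := by
  rw [hconj, Complex.conj_I, map_neg]

theorem exists_fixedField_add_mul_I {F : Type} [Field F] [Algebra ℝ F] [Algebra ℂ F] [IsScalarTower ℝ ℂ F]
    (s : F ≃+* F)
    (hconj : ∀ z : ℂ, s (algebraMap ℂ F z) = algebraMap ℂ F (starRingEnd ℂ z))
    (hs : ∀ x, s (s x) = x) (x : F) :
    ∃ a b : fixedField F s hconj, (a : F) + b * algebraMap ℂ F Complex.I = x := by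
  have : CharZero F := charZero_of_injective_algebraMap (algebraMap ℂ F).injective
  have hI := algebraMap_I_mul_self F
  refine ⟨⟨(x + s x) / 2, ?_⟩, ⟨-(x - s x) * algebraMap ℂ F Complex.I / 2, ?_⟩, ?_⟩
  · simp only [mem_fixedField_iff, map_div₀, map_add, hs, map_ofNat, add_comm]
  · simp only [mem_fixedField_iff, map_div₀, map_mul, map_neg, map_sub, hs, map_ofNat,
      map_algebraMap_I s hconj]
    ring
  · linear_combination (-(x - s x) / 2) * hI

theorem eq_zero_of_add_mul_I_eq_zero {F : Type} [Field F] [Algebra ℝ F] [Algebra ℂ F] [IsScalarTower ℝ ℂ F]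
    (s : F ≃+* F)
    (hconj : ∀ z : ℂ, s (algebraMap ℂ F z) = algebraMap ℂ F (starRingEnd ℂ z))
    {a b : fixedField F s hconj} (h : (a : F) + b * algebraMap ℂ F Complex.I = 0) :
    a = 0 ∧ b = 0 := by
  have : CharZero F := charZero_of_injective_algebraMap (algebraMap ℂ F).injective
  have h' := congrArg s h
  rw [map_add, map_mul, map_algebraMap_I s hconj, map_zero,
    (mem_fixedField_iff s hconj).1 a.2, (mem_fixedField_iff s hconj).1 b.2] at h'
  have ha : (a : F) = 0 := by linear_combination (h + h') / 2
  have hI : algebraMap ℂ F Complex.I ≠ 0 :=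
    (map_ne_zero_iff _ (algebraMap ℂ F).injective).2 Complex.I_ne_zero
  refine ⟨Subtype.ext ha, Subtype.ext ?_⟩
  rw [ha, zero_add] at h
  exact (mul_eq_zero.1 h).resolve_right hI

theorem finrank_fixedField {F : Type} [Field F] [Algebra ℝ F] [Algebra ℂ F] [IsScalarTower ℝ ℂ F]
    (s : F ≃+* F)
    (hconj : ∀ z : ℂ, s (algebraMap ℂ F z) = algebraMap ℂ F (starRingEnd ℂ z))
    (hs : ∀ x, s (s x) = x) : Module.finrank (fixedField F s hconj) F = 2 := by
  have hli : LinearIndependent (fixedField F s hconj) ![1, algebraMap ℂ F Complex.I] := by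
    refine LinearIndependent.pair_iff.2 fun a b h => eq_zero_of_add_mul_I_eq_zero s hconj ?_
    simpa [IntermediateField.smul_def] using h
  have hsp : ⊤ ≤ Submodule.span (fixedField F s hconj)
      (Set.range ![1, algebraMap ℂ F Complex.I]) := by
    intro x _
    obtain ⟨a, b, h⟩ := exists_fixedField_add_mul_I s hconj hs x
    rw [Matrix.range_cons, Matrix.range_cons, Matrix.range_empty, Set.union_empty,
      Set.singleton_union, Submodule.mem_span_pair]
    exact ⟨a, b, by simpa [IntermediateField.smul_def] using h⟩
  simpa using Module.finrank_eq_card_basis (Module.Basis.mk hli hsp)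

theorem fixedField_inter_range_algebraMap {F : Type} [Field F] [Algebra ℝ F] [Algebra ℂ F] [IsScalarTower ℝ ℂ F]
    (s : F ≃+* F)
    (hconj : ∀ z : ℂ, s (algebraMap ℂ F z) = algebraMap ℂ F (starRingEnd ℂ z)) :
    (fixedField F s hconj : Set F) ∩ Set.range (algebraMap ℂ F) =
      Set.range (algebraMap ℝ F) := by
  ext x
  constructor
  · rintro ⟨hx, z, rfl⟩
    have hz : starRingEnd ℂ z = z :=
      (algebraMap ℂ F).injective ((hconj z).symm.trans ((mem_fixedField_iff s hconj).1 hx))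
    obtain ⟨r, rfl⟩ := Complex.conj_eq_iff_real.1 hz
    exact ⟨r, IsScalarTower.algebraMap_apply ℝ ℂ F r⟩
  · rintro ⟨r, rfl⟩
    exact ⟨(fixedField F s hconj).algebraMap_mem r, r,
      (IsScalarTower.algebraMap_apply ℝ ℂ F r).symm⟩

theorem exists_eq_tmul_one_add_tmul_I {M : Type*} [AddCommGroup M] [Module ℝ M]
    (t : M ⊗[ℝ] ℂ) : ∃ a b : M, t = a ⊗ₜ[ℝ] (1 : ℂ) + b ⊗ₜ[ℝ] Complex.I := by
  induction t with
  | zero => exact ⟨0, 0, by simp⟩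
  | tmul m z =>
    refine ⟨z.re • m, z.im • m, ?_⟩
    rw [TensorProduct.smul_tmul, TensorProduct.smul_tmul, ← TensorProduct.tmul_add]
    congr 1
    simp
  | add x y hx hy =>
    obtain ⟨a, b, rfl⟩ := hx
    obtain ⟨c, d, rfl⟩ := hy
    refine ⟨a + c, b + d, ?_⟩
    rw [TensorProduct.add_tmul, TensorProduct.add_tmul]
    abel

theorem bijective_productMap_fixedField {F : Type} [Field F] [Algebra ℝ F] [Algebra ℂ F] [IsScalarTower ℝ ℂ F]
    (s : F ≃+* F)
    (hconj : ∀ z : ℂ, s (algebraMap ℂ F z) = algebraMap ℂ F (starRingEnd ℂ z))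
    (hs : ∀ x, s (s x) = x) :
    Function.Bijective
      (Algebra.TensorProduct.productMap
        (fixedField F s hconj).val
        (IsScalarTower.toAlgHom ℝ ℂ F)) := by
  constructor
  · refine (injective_iff_map_eq_zero _).2 fun t ht => ?_
    obtain ⟨a, b, rfl⟩ := exists_eq_tmul_one_add_tmul_I t
    obtain ⟨rfl, rfl⟩ := eq_zero_of_add_mul_I_eq_zero s hconj (a := a) (b := b)
      (by simpa using ht)
    simp
  · intro x
    obtain ⟨a, b, h⟩ := exists_fixedField_add_mul_I s hconj hs x
    exact ⟨a ⊗ₜ[ℝ] (1 : ℂ) + b ⊗ₜ[ℝ] Complex.I, by simpa using h⟩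

theorem fixed_field_of_involution_index_two_inter_real_and_tensor
    (F : Type) [Field F] [Algebra ℝ F] [Algebra ℂ F] [IsScalarTower ℝ ℂ F]
    (s : F ≃+* F) (hs : ∀ x, s (s x) = x)
    (hconj : ∀ z : ℂ, s (algebraMap ℂ F z) = algebraMap ℂ F (starRingEnd ℂ z)) :
    -- `[F : K] = 2`
    Module.finrank (fixedField F s hconj) F = 2 ∧
    -- `K ∩ ℂ = ℝ` (as subsets of `F`)
    ((fixedField F s hconj : Set F) ∩ Set.range (algebraMap ℂ F)
        = Set.range (algebraMap ℝ F)) ∧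
    -- the multiplication map `K ⊗[ℝ] ℂ → F`, `κ ⊗ z ↦ κ · z`, is an isomorphism
    Function.Bijective
      (Algebra.TensorProduct.productMap
        (fixedField F s hconj).val
        (IsScalarTower.toAlgHom ℝ ℂ F)) := by
  exact ⟨finrank_fixedField s hconj hs, fixedField_inter_range_algebraMap s hconj,
    bijective_productMap_fixedField s hconj hs⟩
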